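/- arXiv:2210.14372 — 4 statements merged into one kernel-verified Lean document; each statement's English description precedes it below -/
import Mathlib

section
/- Let B be an abelian group and H a subgroup of B. If the quotient B_nd = B/B_div of B by its maximal divisible subgroup is torsion of finite exponent, then the quotient (B/H)_nd = (B/H)/(B/H)_div of B/H by its maximal divisible subgroup is also torsion of finite exponent. -/
/-- The maximal divisible subgroup of an abelian group: the supremum of all
divisible subgroups. -/
def divisibleSubgroup (B : Type*) [AddCommGroup B] : AddSubgroup B :=
  sSup {D : AddSubgroup B | ∀ x ∈ D, ∀ n : ℕ, 0 < n → ∃ y ∈ D, n • y = x}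

/-- A homomorphism maps the maximal divisible subgroup into the maximal divisible subgroup. -/
theorem divisibleSubgroup_le_comap {A B : Type*} [AddCommGroup A] [AddCommGroup B] (f : A →+ B) :
    divisibleSubgroup A ≤ (divisibleSubgroup B).comap f := by
  refine sSup_le fun D hD => AddSubgroup.map_le_iff_le_comap.mp (le_sSup ?_)
  rintro _ ⟨x, hx, rfl⟩ n hn
  obtain ⟨y, hy, rfl⟩ := hD x hx n hn
  exact ⟨f y, ⟨y, hy, rfl⟩, (map_nsmul f n y).symm⟩

/-- If `B/B_div` is torsion of finite exponent, then for any subgroup `H ≤ B`,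
`(B/H)/(B/H)_div` is torsion of finite exponent. -/
theorem stmt0 (B : Type*) [AddCommGroup B] (H : AddSubgroup B)
    (hB : ∃ N : ℕ, 0 < N ∧ ∀ x : B ⧸ divisibleSubgroup B, N • x = 0) :
    ∃ N : ℕ, 0 < N ∧
      ∀ x : (B ⧸ H) ⧸ divisibleSubgroup (B ⧸ H), N • x = 0 := by
  obtain ⟨N, hN, h⟩ := hB
  refine ⟨N, hN, fun x => ?_⟩
  obtain ⟨y, rfl⟩ := QuotientAddGroup.mk_surjective x
  obtain ⟨b, rfl⟩ := QuotientAddGroup.mk_surjective y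
  have hb : N • b ∈ divisibleSubgroup B :=
    (QuotientAddGroup.eq_zero_iff (N • b)).mp (h (b : B ⧸ divisibleSubgroup B))
  exact (QuotientAddGroup.eq_zero_iff (N • (b : B ⧸ H))).mpr
    (divisibleSubgroup_le_comap (QuotientAddGroup.mk' H) hb)
end

section
/- Let B be an abelian group and H a subgroup of B. If the quotient B_nd = B/B_div of B by its maximal divisible subgroup is a finite group, then the quotient (B/H)_nd = (B/H)/(B/H)_div of B/H by its maximal divisible subgroup is also a finite group. -/
/-- If `B/B_div` is finite, then for any subgroup `H ≤ B`,
`(B/H)/(B/H)_div` is finite. -/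
theorem stmt1 (B : Type*) [AddCommGroup B] (H : AddSubgroup B)
    (hB : Finite (B ⧸ divisibleSubgroup B)) :
    Finite ((B ⧸ H) ⧸ divisibleSubgroup (B ⧸ H)) := by
  refine Finite.of_surjective (QuotientAddGroup.map _ _ (QuotientAddGroup.mk' H)
    (divisibleSubgroup_le_comap _)) ?_
  exact QuotientAddGroup.map_surjective_of_surjective _ _ _
    ((QuotientAddGroup.mk'_surjective _).comp (QuotientAddGroup.mk'_surjective H)) _
end

section
/- Let B be an abelian group and let N be a positive integer such that N annihilates the quotient B_nd = B/B_div of B by its maximal divisible subgroup. If the N-torsion subgroup {b ∈ B : N·b = 0} of B is finite, then B_nd is a finite group. -/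
/-- The maximal divisible subgroup is itself divisible. -/
theorem exists_nsmul_eq_of_mem_divisibleSubgroup {B : Type*} [AddCommGroup B] {x : B}
    (hx : x ∈ divisibleSubgroup B) {n : ℕ} (hn : 0 < n) :
    ∃ y ∈ divisibleSubgroup B, n • y = x := by
  have h : divisibleSubgroup B ≤ (divisibleSubgroup B).map (nsmulAddMonoidHom n) := by
    refine sSup_le fun D hD z hz => ?_
    obtain ⟨y, hy, hyz⟩ := hD z hz n hn
    exact ⟨y, le_sSup (a := D) hD hy, hyz⟩
  exact h hx

/-- If `N` annihilates `B/B_div` and the `N`-torsion subgroup of `B` is finite,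
then `B/B_div` is finite. -/
theorem stmt5 (B : Type*) [AddCommGroup B] (N : ℕ) (hN : 0 < N)
    (hann : ∀ x : B ⧸ divisibleSubgroup B, N • x = 0)
    (hfin : Finite {b : B // N • b = 0}) :
    Finite (B ⧸ divisibleSubgroup B) := by
  refine Finite.of_surjective
    (fun b : {b : B // N • b = 0} => (b.1 : B ⧸ divisibleSubgroup B)) fun q => ?_
  obtain ⟨x, rfl⟩ := QuotientAddGroup.mk_surjective q
  have hx : N • x ∈ divisibleSubgroup B := by
    rw [← QuotientAddGroup.eq_zero_iff, QuotientAddGroup.mk_nsmul]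
    exact hann x
  obtain ⟨d, hd, hdx⟩ := exists_nsmul_eq_of_mem_divisibleSubgroup hx hN
  refine ⟨⟨x - d, by rw [nsmul_sub, hdx, sub_self]⟩, ?_⟩
  simp [QuotientAddGroup.mk_sub, (QuotientAddGroup.eq_zero_iff d).2 hd]
end

section
/- Let A and B be abelian groups and let f : A → B and g : B → A be group homomorphisms such that g ∘ f equals multiplication by a positive integer m on A and f ∘ g equals multiplication by m on B. Let p be a prime number not dividing m. Then for every positive integer n, the homomorphism induced by f from the quotient A/p^n·A to the quotient B/p^n·B is an isomorphism. -/
/-- The subgroup `k • A` of all multiples by `k` of elements of an abelian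
group `A`. -/
def smulSubgroup (k : ℕ) (A : Type*) [AddCommGroup A] : AddSubgroup A where
  carrier := {a | ∃ x : A, k • x = a}
  zero_mem' := ⟨0, smul_zero k⟩
  add_mem' := by
    rintro a b ⟨x, hx⟩ ⟨y, hy⟩
    exact ⟨x + y, by rw [smul_add, hx, hy]⟩
  neg_mem' := by
    rintro a ⟨x, hx⟩
    exact ⟨-x, by rw [smul_neg, hx]⟩

/-- Bézout's identity acting on an element of an abelian group. -/
theorem exists_zsmul_nsmul_add_zsmul_nsmul {k m : ℕ} (h : k.Coprime m)
    {A : Type*} [AddCommGroup A] (a : A) :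
    ∃ u v : ℤ, k • (u • a) + m • (v • a) = a := by
  refine ⟨k.gcdA m, k.gcdB m, ?_⟩
  have hb : (k : ℤ) * k.gcdA m + m * k.gcdB m = 1 := by
    rw [← Nat.gcd_eq_gcd_ab, h, Nat.cast_one]
  rw [← natCast_zsmul, ← natCast_zsmul, smul_smul, smul_smul, ← add_zsmul, hb, one_zsmul]

/-- If `g ∘ f = m` on `A`, `f ∘ g = m` on `B`, and `p` is a prime not dividing
`m`, then the homomorphism induced by `f` from `A/p^n·A` to `B/p^n·B` is an
isomorphism for every `n ≥ 1`. -/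
theorem stmt8 (A B : Type*) [AddCommGroup A] [AddCommGroup B]
    (f : A →+ B) (g : B →+ A) (m : ℕ) (hm : 0 < m)
    (hgf : ∀ a : A, g (f a) = m • a) (hfg : ∀ b : B, f (g b) = m • b)
    (p : ℕ) (hp : p.Prime) (hpm : ¬ p ∣ m) (n : ℕ) (hn : 0 < n) :
    Function.Bijective
      (QuotientAddGroup.map (smulSubgroup (p ^ n) A) (smulSubgroup (p ^ n) B) f
        (by rintro a ⟨x, hx⟩; exact ⟨f x, by rw [← map_nsmul, hx]⟩)) := by
  have hc : (p ^ n).Coprime m := ((Nat.Prime.coprime_iff_not_dvd hp).2 hpm).pow_left n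
  constructor
  · rw [injective_iff_map_eq_zero]
    intro q hq
    induction q using QuotientAddGroup.induction_on with | H a => ?_
    rw [QuotientAddGroup.map_mk, QuotientAddGroup.eq_zero_iff] at hq
    rw [QuotientAddGroup.eq_zero_iff]
    obtain ⟨y, hy⟩ := hq
    obtain ⟨u, v, h⟩ := exists_zsmul_nsmul_add_zsmul_nsmul hc a
    refine ⟨u • a + v • g y, ?_⟩
    rw [smul_add, smul_comm _ v, ← map_nsmul, hy, hgf, smul_comm v m, h]
  · intro q
    induction q using QuotientAddGroup.induction_on with | H b => ?_
    obtain ⟨u, v, h⟩ := exists_zsmul_nsmul_add_zsmul_nsmul hc b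
    refine ⟨QuotientAddGroup.mk (g (v • b)), ?_⟩
    rw [QuotientAddGroup.map_mk, QuotientAddGroup.eq, hfg]
    exact ⟨u • b, eq_neg_add_of_add_eq (by rw [add_comm, h])⟩
end
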